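/- Let G be a finite group acting on a commutative ring R by ring automorphisms such that the order |G| of G is invertible in R, and let ρ_R denote the twisted regular representation of G over R. Let P be an (R,G)-module that is finitely generated and projective as an R-module. Then there exist a natural number n and R-linear, G-equivariant maps i : P → (Fin n → ρ_R) and p : (Fin n → ρ_R) → P with p ∘ i = id_P, where G acts on the n-fold product componentwise. In other words, every finitely generated projective equivariant R-module is an equivariant direct summand of a finite direct sum of copies of the twisted regular representation. -/

import Mathlib

/-- The twisted regular representation of `G` over `R`: the `R`-module of functions `G → R`
with the `G`-action `(g • f) h = g • f (g⁻¹ * h)`. -/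
def rhoAct (G R : Type*) [Group G] [CommRing R] [MulSemiringAction G R]
    (g : G) (f : G → R) : G → R :=
  fun h => g • f (g⁻¹ * h)

/-- **Lemma 3.2.** Let `G` be a finite group acting on a commutative ring `R` by ring
automorphisms with `|G|` invertible in `R`, and let `P` be an `(R,G)`-module (compatibility
hypothesis `hP`) which is finitely generated and projective as an `R`-module.  Then `P` is a
`G`-equivariant direct summand of a finite direct sum `(Fin n → G → R)` of copies of the
twisted regular representation `ρ_R = (G → R)`, the `G`-action on the direct sum being
componentwise `rhoAct`. -/
theorem summand_of_regular_representations
    (G R P : Type*) [Group G] [Fintype G] [CommRing R] [MulSemiringAction G R]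
    [Invertible (Fintype.card G : R)]
    [AddCommGroup P] [Module R P] [DistribMulAction G P]
    (hP : ∀ (g : G) (r : R) (m : P), g • (r • m) = (g • r) • (g • m))
    [Module.Finite R P] [Module.Projective R P] :
    ∃ (n : ℕ) (i : P →ₗ[R] (Fin n → G → R)) (p : (Fin n → G → R) →ₗ[R] P),
      (∀ (g : G) (x : P) (j : Fin n), i (g • x) j = rhoAct G R g (i x j)) ∧
      (∀ (g : G) (v : Fin n → G → R), p (fun j => rhoAct G R g (v j)) = g • p v) ∧
      (∀ x : P, p (i x) = x) := by
  obtain ⟨n, b, a, -, -, hba⟩ := Module.Finite.exists_comp_eq_id_of_projective R P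
  have hba' (x : P) : b (a x) = x := LinearMap.congr_fun hba x
  set c : R := ⅟(Fintype.card G : R) with hc
  have hgc (g : G) : g • c = c := by
    have h : (g • c) * (Fintype.card G : R) = 1 := by
      have := congrArg (g • ·) (invOf_mul_self (Fintype.card G : R))
      have hcard : g • (Fintype.card G : R) = (Fintype.card G : R) :=
        map_natCast (MulSemiringAction.toRingHom G R g) _
      simpa only [smul_mul', smul_one, hcard] using this
    exact (invOf_eq_left_inv h).symm
  let i : P →ₗ[R] (Fin n → G → R) :=
    { toFun := fun x j h => h • a (h⁻¹ • x) j
      map_add' := fun x y => by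
        ext j h
        simp [smul_add]
      map_smul' := fun r x => by
        ext j h
        simp [hP, smul_mul'] }
  let p : (Fin n → G → R) →ₗ[R] P :=
    { toFun := fun v => c • ∑ h : G, h • b (fun j => h⁻¹ • v j h)
      map_add' := fun v w => by
        rw [← smul_add, ← Finset.sum_add_distrib]
        congr 1
        refine Finset.sum_congr rfl fun h _ => ?_
        rw [← smul_add, ← map_add]
        congr 2
        ext j
        simp [smul_add]
      map_smul' := fun r v => by
        rw [RingHom.id_apply, smul_comm r c, Finset.smul_sum (r := r)]
        congr 1
        refine Finset.sum_congr rfl fun h _ => ?_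
        have : (fun j => h⁻¹ • (r • v) j h) = (h⁻¹ • r) • fun j => h⁻¹ • v j h := by
          ext j
          simp [smul_mul']
        rw [this, b.map_smul, hP, smul_inv_smul] }
  refine ⟨n, i, p, fun g x j => ?_, fun g v => ?_, fun x => ?_⟩
  · ext h
    change h • a (h⁻¹ • g • x) j = g • (g⁻¹ * h) • a ((g⁻¹ * h)⁻¹ • x) j
    simp [smul_smul]
  · change c • ∑ h : G, h • b (fun j => h⁻¹ • g • v j (g⁻¹ * h)) =
      g • c • ∑ h : G, h • b (fun j => h⁻¹ • v j h)
    rw [hP, hgc, Finset.smul_sum (r := g), ← Equiv.sum_comp (Equiv.mulLeft g)]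
    simp [smul_smul]
  · change c • ∑ h : G, h • b (fun j => h⁻¹ • h • a (h⁻¹ • x) j) = x
    have hterm (h : G) : h • b (fun j => h⁻¹ • h • a (h⁻¹ • x) j) = x := by
      simp only [inv_smul_smul]
      exact (congrArg (h • ·) (hba' _)).trans (smul_inv_smul h x)
    simp only [hterm, Finset.sum_const, Finset.card_univ]
    rw [← Nat.cast_smul_eq_nsmul R, smul_smul, hc, invOf_mul_self, one_smul]
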